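/- Let X be a generalized Baumslag–Solitar tree with group G, and assume X contains no G-invariant point or line. If G splits over a 2-ended subgroup C (i.e. G = A ∗_C B with A ≠ C ≠ B, or G = A ∗_C as an HNN extension), then C is contained in a vertex stabilizer of X. -/

import Mathlib

open SimpleGraph

section Defs

variable {G V : Type} [Group G]

/-- The action `ρ` preserves adjacency of the graph `X`. -/
def PreservesAdj (X : SimpleGraph V) (ρ : G →* Equiv.Perm V) : Prop :=
  ∀ (g : G) (u v : V), X.Adj u v → X.Adj (ρ g u) (ρ g v)

/-- The action is without inversions: no element swaps the endpoints of an edge. -/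
def NoInversions (X : SimpleGraph V) (ρ : G →* Equiv.Perm V) : Prop :=
  ∀ (g : G) (u v : V), X.Adj u v → ¬(ρ g u = v ∧ ρ g v = u)

/-- `X` together with `ρ` is a `G`-tree: a tree with a `G`-action by graph
automorphisms, without inversions. -/
def IsGTree (X : SimpleGraph V) (ρ : G →* Equiv.Perm V) : Prop :=
  X.IsTree ∧ PreservesAdj X ρ ∧ NoInversions X ρ

/-- The stabilizer of a vertex. -/
def vStab (ρ : G →* Equiv.Perm V) (v : V) : Subgroup G :=
  (MulAction.stabilizer (Equiv.Perm V) v).comap ρ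

/-- The stabilizer of an edge (for an action without inversions this is the
intersection of the stabilizers of the two endpoints). -/
def eStab (ρ : G →* Equiv.Perm V) (u v : V) : Subgroup G :=
  vStab ρ u ⊓ vStab ρ v

/-- An element is elliptic if it fixes a vertex; it is hyperbolic otherwise. -/
def Elliptic (ρ : G →* Equiv.Perm V) (γ : G) : Prop := ∃ v : V, ρ γ v = v

/-- A (bi-infinite) line in a graph. -/
def IsLine (X : SimpleGraph V) (L : Set V) : Prop :=
  ∃ f : ℤ → V, Function.Injective f ∧ (∀ n : ℤ, X.Adj (f n) (f (n + 1))) ∧ L = Set.range f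

/-- A set of vertices invariant under the element `γ`. -/
def InvariantSet (ρ : G →* Equiv.Perm V) (γ : G) (L : Set V) : Prop :=
  ⇑(ρ γ) '' L = L

/-- An axis for `γ` : a `γ`-invariant line. (A hyperbolic element has a unique one.) -/
def IsAxis (X : SimpleGraph V) (ρ : G →* Equiv.Perm V) (γ : G) (L : Set V) : Prop :=
  IsLine X L ∧ InvariantSet ρ γ L

/-- A subgroup is infinite cyclic. -/
def IsInfCyclic {G : Type} [Group G] (H : Subgroup G) : Prop := IsCyclic H ∧ Infinite H

/-- A generalized Baumslag–Solitar tree: a `G`-tree all of whose vertex and edge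
stabilizers are infinite cyclic. -/
def IsGBSTree (X : SimpleGraph V) (ρ : G →* Equiv.Perm V) : Prop :=
  IsGTree X ρ ∧ (∀ v : V, IsInfCyclic (vStab ρ v)) ∧
    (∀ u v : V, X.Adj u v → IsInfCyclic (eStab ρ u v))

/-- Two group elements are commensurable: some nonzero powers of them coincide. -/
def CommElts (γ δ : G) : Prop := ∃ m n : ℤ, m ≠ 0 ∧ n ≠ 0 ∧ γ ^ m = δ ^ n

/-- A generalized Baumslag–Solitar group: a group admitting a GBS tree. -/
def IsGBSGroup (G : Type) [Group G] : Prop :=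
  ∃ (V : Type) (X : SimpleGraph V) (ρ : G →* Equiv.Perm V), IsGBSTree X ρ

/-- A group is free: isomorphic to a free group on some set. -/
def IsFreeGrp (G : Type) [Group G] : Prop := ∃ ι : Type, Nonempty (G ≃* FreeGroup ι)

/-- The orbit of the edge `{a, b}` under the action. -/
def EdgeOrbit (ρ : G →* Equiv.Perm V) (a b : V) : Set (Sym2 V) :=
  {e | ∃ g : G, e = s(ρ g a, ρ g b)}

/-- A one-edge splitting of `G` over `C`: a `G`-tree with a single orbit of edges,
no global fixed vertex, and an edge with stabilizer `C` (this is the Bass–Serre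
tree of a nontrivial decomposition `A ∗_C B` or `A ∗_C`). -/
def OneEdgeSplitting (X : SimpleGraph V) (ρ : G →* Equiv.Perm V) (u v : V)
    (C : Subgroup G) : Prop :=
  IsGTree X ρ ∧ X.Adj u v ∧ eStab ρ u v = C ∧
  (¬ ∃ w : V, ∀ g : G, ρ g w = w) ∧
  (∀ u' v' : V, X.Adj u' v' → ∃ g : G, (ρ g u = u' ∧ ρ g v = v') ∨ (ρ g u = v' ∧ ρ g v = u'))

/-- `G` splits over the subgroup `C`. -/
def SplitsOver (G : Type) [Group G] (C : Subgroup G) : Prop :=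
  ∃ (W : Type) (T : SimpleGraph W) (σ : G →* Equiv.Perm W) (u v : W),
    OneEdgeSplitting T σ u v C

/-- Cayley graph of a group with respect to a set of generators. -/
def cayley (G : Type) [Group G] (S : Set G) : SimpleGraph G :=
  SimpleGraph.fromRel (fun a b => a⁻¹ * b ∈ S)

end Defs

/-- A group is 2-ended: the Cayley graph with respect to some (equivalently any)
finite generating set has exactly two ends. -/
def TwoEnded (C : Type) [Group C] : Prop :=
  ∃ S : Finset C, Subgroup.closure (S : Set C) = ⊤ ∧
    Nat.card (SimpleGraph.end (cayley C (S : Set C))) = 2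


section TreeLemmas

variable {G V : Type} [Group G]

theorem gtree_dist (X : SimpleGraph V) (ρ : G →* Equiv.Perm V) (hX : IsGTree X ρ) (g : G)
    (u v : V) : X.dist (ρ g u) (ρ g v) = X.dist u v := by
  have key : ∀ (g : G) (u v : V), X.dist (ρ g u) (ρ g v) ≤ X.dist u v := by
    intro g u v
    obtain ⟨p, hp⟩ := hX.1.connected.exists_walk_length_eq_dist u v
    let φ : X →g X := ⟨ρ g, fun h => hX.2.1 g _ _ h⟩
    have := SimpleGraph.dist_le (p.map φ)
    rw [SimpleGraph.Walk.length_map, hp] at this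
    exact this
  refine le_antisymm (key g u v) ?_
  have := key g⁻¹ (ρ g u) (ρ g v)
  simpa [← Equiv.Perm.mul_apply, ← map_mul] using this

theorem tree_closer_unique {X : SimpleGraph V} (hT : X.IsTree) {r x y z : V}
    (hy : X.Adj y x) (hz : X.Adj z x) (dy : X.dist r y + 1 = X.dist r x)
    (dz : X.dist r z + 1 = X.dist r x) : y = z := by
  obtain ⟨p, hp⟩ := hT.connected.exists_walk_length_eq_dist r y
  obtain ⟨q, hq⟩ := hT.connected.exists_walk_length_eq_dist r z
  have h1 : (p.concat hy).IsPath :=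
    SimpleGraph.Walk.isPath_of_length_eq_dist _ (by simp [hp, dy])
  have h2 : (q.concat hz).IsPath :=
    SimpleGraph.Walk.isPath_of_length_eq_dist _ (by simp [hq, dz])
  have h3 := (hT.isAcyclic.subsingleton_path _ _).elim ⟨_, h1⟩ ⟨_, h2⟩
  have h4 : p.concat hy = q.concat hz := congrArg Subtype.val h3
  have h5 := congrArg SimpleGraph.Walk.penultimate h4
  simpa using h5

theorem tree_between_mem {X : SimpleGraph V} (hT : X.IsTree) {x p y : V}
    (h : X.dist x p + X.dist p y = X.dist x y) (w : X.Walk x y) : p ∈ w.support := by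
  classical
  obtain ⟨a, ha⟩ := hT.connected.exists_walk_length_eq_dist x p
  obtain ⟨b, hb⟩ := hT.connected.exists_walk_length_eq_dist p y
  have h1 : (a.append b).IsPath :=
    SimpleGraph.Walk.isPath_of_length_eq_dist _ (by simp [ha, hb, h])
  have h3 := (hT.isAcyclic.subsingleton_path _ _).elim ⟨_, h1⟩ ⟨_, w.bypass_isPath⟩
  have h4 : a.append b = w.bypass := congrArg Subtype.val h3
  apply SimpleGraph.Walk.support_bypass_subset_support
  rw [← h4]
  simp

/-- A bi-infinite geodesic. -/
def GeoLine (X : SimpleGraph V) (f : ℤ → V) : Prop :=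
  (∀ n, X.Adj (f n) (f (n + 1))) ∧ ∀ m n, X.dist (f m) (f n) = (n - m).natAbs

theorem geoLine_of_nonbacktrack {X : SimpleGraph V} (hT : X.IsTree) (f : ℤ → V)
    (hadj : ∀ n, X.Adj (f n) (f (n + 1))) (hnb : ∀ n, f n ≠ f (n + 2)) : GeoLine X f := by
  have key : ∀ (n : ℤ) (k : ℕ), X.dist (f n) (f (n + k)) = k ∧
      X.dist (f n) (f (n + k + 1)) = k + 1 := by
    intro n k
    induction k with
    | zero => simpa using (SimpleGraph.dist_eq_one_iff_adj.2 (hadj n))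
    | succ k ih =>
      obtain ⟨h1, h2⟩ := ih
      push_cast
      rw [← add_assoc]
      refine ⟨h2, ?_⟩
      rcases hT.dist_eq_dist_add_one_of_adj (f n) (hadj (n + k + 1)) with h | h
      · exfalso
        apply hnb (n + k)
        have e : n + (k : ℤ) + 1 + 1 = n + k + 2 := by ring
        rw [e] at h
        have a2 := hadj (n + k + 1)
        rw [e] at a2
        refine tree_closer_unique hT (r := f n) (hadj (n + k)) a2.symm ?_ ?_ <;> omega
      · omega
  refine ⟨hadj, fun m n => ?_⟩
  rcases le_total m n with h | h
  · obtain ⟨k, hk⟩ := Int.le.dest h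
    rw [← hk, (key m k).1]
    omega
  · obtain ⟨k, hk⟩ := Int.le.dest h
    rw [← hk, SimpleGraph.dist_comm, (key n k).1]
    omega

theorem GeoLine.inj {X : SimpleGraph V} {f : ℤ → V} (h : GeoLine X f) : Function.Injective f := by
  intro m n hmn
  have := h.2 m n
  rw [hmn, SimpleGraph.dist_self] at this
  omega

theorem GeoLine.isLine {X : SimpleGraph V} {f : ℤ → V} (h : GeoLine X f) :
    IsLine X (Set.range f) := ⟨f, h.inj, h.1, rfl⟩

theorem exists_axis (X : SimpleGraph V) (ρ : G →* Equiv.Perm V) (hX : IsGTree X ρ) (b : G)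
    (hb : ¬ Elliptic ρ b) : ∃ (f : ℤ → V) (l : ℤ), l ≠ 0 ∧ GeoLine X f ∧
      ∀ n, ρ b (f n) = f (n + l) := by
  have hT := hX.1
  have := hT.connected.nonempty
  obtain ⟨v, hv⟩ : ∃ v, ∀ w, X.dist v (ρ b v) ≤ X.dist w (ρ b w) :=
    ⟨Function.argmin (fun v => X.dist v (ρ b v)), fun w => Function.argmin_le (fun v => X.dist v (ρ b v)) w⟩
  obtain ⟨p, hp⟩ := hT.connected.exists_walk_length_eq_dist v (ρ b v)
  have hpp := SimpleGraph.Walk.isPath_of_length_eq_dist _ hp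
  set l : ℕ := p.length with hl
  have hl0 : 0 < l := by
    rcases Nat.eq_zero_or_pos l with h | h
    · exfalso
      apply hb
      refine ⟨v, ?_⟩
      rw [h] at hp
      exact ((hT.connected.dist_eq_zero_iff).1 hp.symm).symm
    · exact h
  let q : ℕ → V := p.getVert
  have q0 : q 0 = v := p.getVert_zero
  have ql : q l = ρ b v := p.getVert_length
  have qadj : ∀ i, i < l → X.Adj (q i) (q (i + 1)) := fun i hi => p.adj_getVert_succ hi
  have qinj : ∀ i j, i ≤ l → j ≤ l → q i = q j → i = j := fun i j hi hj h =>
    hpp.getVert_injOn hi hj h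
  have qd : ∀ i k, i + k ≤ l → X.dist (q i) (q (i + k)) ≤ k := by
    intro i k
    induction k with
    | zero => intro _; simp
    | succ k ih =>
      intro h
      have h1 := ih (by omega)
      have h2 := hT.connected.dist_triangle (u := q i) (v := q (i + k)) (w := q (i + (k + 1)))
      have h3 : X.dist (q (i + k)) (q (i + (k + 1))) = 1 :=
        SimpleGraph.dist_eq_one_iff_adj.2 (qadj (i + k) (by omega))
      omega
  let f : ℤ → V := fun n => ρ (b ^ (n / l)) (q (n % l).toNat)
  have hf0 : ∀ (k : ℤ) (i : ℕ), i < l → f (l * k + i) = ρ (b ^ k) (q i) := by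
    intro k i hi
    have e1 : ((l : ℤ) * k + i) / l = k := by
      rw [Int.mul_add_ediv_left _ _ (by omega), Int.ediv_eq_zero_of_lt (by omega) (by omega)]
      simp
    have e2 : ((l : ℤ) * k + i) % l = i := by
      rw [Int.mul_add_emod_self_left, Int.emod_eq_of_lt (by omega) (by omega)]
    simp only [f, e1, e2, Int.toNat_natCast]
  have hf : ∀ (k : ℤ) (i : ℕ), i ≤ l → f (l * k + i) = ρ (b ^ k) (q i) := by
    intro k i hi
    rcases Nat.lt_or_eq_of_le hi with h | h
    · exact hf0 k i h
    · rw [h]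
      have := hf0 (k + 1) 0 hl0
      have e : (l : ℤ) * k + l = l * (k + 1) + (0 : ℕ) := by push_cast; ring
      rw [e, this, ql, q0, zpow_add_one, map_mul, Equiv.Perm.mul_apply]
  have hdecomp : ∀ n : ℤ, ∃ (k : ℤ) (i : ℕ), i < l ∧ n = l * k + i := by
    intro n
    refine ⟨n / l, (n % l).toNat, ?_, ?_⟩
    · have := Int.emod_lt_of_pos n (b := (l : ℤ)) (by omega)
      omega
    · have := Int.emod_nonneg n (b := (l : ℤ)) (by omega)
      have h2 := Int.mul_ediv_add_emod n l
      rw [Int.toNat_of_nonneg this]; omega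
  refine ⟨f, l, by omega, geoLine_of_nonbacktrack hT f ?_ ?_, ?_⟩
  · intro n
    obtain ⟨k, i, hi, rfl⟩ := hdecomp n
    have := hf k (i + 1) hi
    push_cast at this
    rw [← add_assoc] at this
    rw [this, hf k i hi.le]
    exact hX.2.1 _ _ _ (qadj i hi)
  · intro n
    obtain ⟨k, i, hi, rfl⟩ := hdecomp n
    by_cases h2 : i + 2 ≤ l
    · have := hf k (i + 2) h2
      push_cast at this
      rw [← add_assoc] at this
      rw [this, hf k i hi.le]
      intro h
      have := qinj _ _ hi.le h2 ((ρ (b ^ k)).injective h)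
      omega
    · have h3 : i + 1 = l := by omega
      have := hf (k + 1) 1 (by omega)
      have e : (l : ℤ) * k + i + 2 = l * (k + 1) + (1 : ℕ) := by
        rw [← h3]; push_cast; ring
      rw [e, this, hf k i hi.le, zpow_add_one, map_mul, Equiv.Perm.mul_apply]
      intro h
      have h4 : q i = ρ b (q 1) := (ρ (b ^ k)).injective h
      by_cases h5 : i = 0
      · subst h5
        have ql' : q 1 = ρ b (q 0) := by rw [q0, ← ql, ← h3]
        exact hX.2.2 b (q 0) (q 1) (qadj 0 hl0) ⟨ql'.symm, h4.symm⟩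
      · have h6 := hv (q 1)
        rw [← h4, ← hp] at h6
        have h7 := qd 1 (i - 1) (by omega)
        have h8 : 1 + (i - 1) = i := by omega
        rw [h8] at h7
        omega
  · intro n
    obtain ⟨k, i, hi, rfl⟩ := hdecomp n
    have e : (l : ℤ) * k + i + l = l * (k + 1) + i := by ring
    rw [e, hf _ i hi.le, hf _ i hi.le, add_comm k 1, zpow_add, map_mul, Equiv.Perm.mul_apply,
      zpow_one]

theorem axis_zpow (ρ : G →* Equiv.Perm V) {b : G} {f : ℤ → V} {l : ℤ}
    (h : ∀ n, ρ b (f n) = f (n + l)) (k : ℤ) (n : ℤ) : ρ (b ^ k) (f n) = f (n + k * l) := by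
  induction k using Int.induction_on generalizing n with
  | zero => simp
  | succ k ih =>
    rw [zpow_add_one, map_mul, Equiv.Perm.mul_apply, h, ih]
    congr 1; ring
  | pred k ih =>
    rw [zpow_sub_one, map_mul, Equiv.Perm.mul_apply]
    have : ρ b⁻¹ (f n) = f (n - l) := by
      rw [map_inv, Equiv.Perm.inv_eq_iff_eq, h]; simp
    rw [this, ih]
    congr 1; ring

theorem line_walk {X : SimpleGraph V} {f : ℤ → V} (h : GeoLine X f) (m n : ℤ) :
    ∃ w : X.Walk (f m) (f n), ∀ x ∈ w.support, x ∈ Set.range f := by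
  refine Int.inductionOn' (motive := fun n => ∃ w : X.Walk (f m) (f n),
    ∀ x ∈ w.support, x ∈ Set.range f) n m ⟨.nil, by simp⟩ ?_ ?_
  · intro k _ ih
    obtain ⟨w, hw⟩ := ih
    refine ⟨w.concat (h.1 k), ?_⟩
    intro x hx
    rw [SimpleGraph.Walk.support_concat] at hx
    simp at hx
    rcases hx with hx | rfl
    · exact hw x hx
    · simp
  · intro k _ ih
    obtain ⟨w, hw⟩ := ih
    have := h.1 (k - 1)
    rw [sub_add_cancel] at this
    refine ⟨w.concat this.symm, ?_⟩
    intro x hx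
    rw [SimpleGraph.Walk.support_concat] at hx
    simp at hx
    rcases hx with hx | rfl
    · exact hw x hx
    · simp

theorem axis_subset (X : SimpleGraph V) (ρ : G →* Equiv.Perm V) (hX : IsGTree X ρ) {b : G}
    {f f' : ℤ → V} {l l' : ℤ} (hf : GeoLine X f) (hf' : GeoLine X f') (hl' : l' ≠ 0)
    (h : ∀ n, ρ b (f n) = f (n + l)) (h' : ∀ n, ρ b (f' n) = f' (n + l')) :
    Set.range f' ⊆ Set.range f := by
  classical
  rintro _ ⟨j, rfl⟩
  set D := X.dist (f' j) (f 0) with hD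
  have hk : ∀ k : ℤ, X.dist (f' (j + k * l')) (f (0 + k * l)) = D := by
    intro k
    rw [← axis_zpow ρ h, ← axis_zpow ρ h', gtree_dist X ρ hX]
  obtain ⟨w1, hw1⟩ := hX.1.connected.exists_walk_length_eq_dist
    (f' (j + (-(D + 1 : ℤ)) * l')) (f (0 + (-(D + 1 : ℤ)) * l))
  obtain ⟨w3, hw3⟩ := hX.1.connected.exists_walk_length_eq_dist
    (f' (j + ((D + 1 : ℤ)) * l')) (f (0 + ((D + 1 : ℤ)) * l))
  rw [hk] at hw1 hw3
  obtain ⟨w2, hw2⟩ := line_walk hf (0 + (-(D + 1 : ℤ)) * l) (0 + ((D + 1 : ℤ)) * l)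
  have big : D + 1 ≤ ((D + 1 : ℤ) * l').natAbs := by
    rw [Int.natAbs_mul]
    have : 1 ≤ l'.natAbs := by omega
    have h2 : (D + 1 : ℤ).natAbs = D + 1 := by omega
    rw [h2]
    exact Nat.le_mul_of_pos_right _ this
  have d1 : X.dist (f' (j + (-(D + 1 : ℤ)) * l')) (f' j) = ((D + 1 : ℤ) * l').natAbs := by
    rw [hf'.2]; congr 1; ring
  have d2 : X.dist (f' j) (f' (j + ((D + 1 : ℤ)) * l')) = ((D + 1 : ℤ) * l').natAbs := by
    rw [hf'.2]; congr 1; ring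
  have d3 : X.dist (f' (j + (-(D + 1 : ℤ)) * l')) (f' (j + ((D + 1 : ℤ)) * l'))
      = 2 * ((D + 1 : ℤ) * l').natAbs := by
    rw [hf'.2]
    have : j + (D + 1 : ℤ) * l' - (j + -(D + 1 : ℤ) * l') = 2 * ((D + 1 : ℤ) * l') := by ring
    rw [this, Int.natAbs_mul]; rfl
  have hmem := tree_between_mem hX.1 (p := f' j) (by rw [d1, d2, d3]; ring)
    ((w1.append w2).append w3.reverse)
  rw [SimpleGraph.Walk.mem_support_append_iff, SimpleGraph.Walk.mem_support_append_iff] at hmem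
  rcases hmem with (hm | hm) | hm
  · exfalso
    have a1 := SimpleGraph.dist_le (w1.takeUntil _ hm)
    have a2 := w1.length_takeUntil_le_length hm
    omega
  · exact hw2 _ hm
  · exfalso
    rw [SimpleGraph.Walk.support_reverse, List.mem_reverse] at hm
    have a1 := SimpleGraph.dist_le (w3.takeUntil _ hm)
    have a2 := w3.length_takeUntil_le_length hm
    rw [SimpleGraph.dist_comm] at a1
    omega

theorem geoLine_translate (X : SimpleGraph V) (ρ : G →* Equiv.Perm V) (hX : IsGTree X ρ) (g : G)
    {f : ℤ → V} (hf : GeoLine X f) : GeoLine X (fun n => ρ g (f n)) :=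
  ⟨fun n => hX.2.1 _ _ _ (hf.1 n), fun m n => by rw [gtree_dist X ρ hX, hf.2]⟩

/-- If `g b g⁻¹` is commensurable to `b`, then `g` preserves the axis of `b`. -/
theorem axis_invariant (X : SimpleGraph V) (ρ : G →* Equiv.Perm V) (hX : IsGTree X ρ) {b g : G}
    {f : ℤ → V} {l : ℤ} (hf : GeoLine X f) (hl : l ≠ 0)
    (h : ∀ n, ρ b (f n) = f (n + l)) (hc : CommElts (g * b * g⁻¹) b) :
    ⇑(ρ g) '' (Set.range f) = Set.range f := by
  obtain ⟨m, n, hm, hn, e⟩ := hc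
  have h1 : ∀ i, ρ (b ^ n) (f i) = f (i + n * l) := axis_zpow ρ h n
  have h2 : ∀ i, ρ (b ^ n) (ρ g (f i)) = ρ g (f (i + m * l)) := by
    intro i
    rw [← e, conj_zpow, ← axis_zpow ρ h m]
    simp only [map_mul, Equiv.Perm.mul_apply, map_inv]
    simp
  rw [← Set.range_comp]
  apply subset_antisymm
  · exact axis_subset X ρ hX hf (geoLine_translate X ρ hX g hf) (mul_ne_zero hm hl) h1 h2
  · exact axis_subset X ρ hX (geoLine_translate X ρ hX g hf) hf (mul_ne_zero hn hl) h2 h1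

theorem hyp_zpow (X : SimpleGraph V) (ρ : G →* Equiv.Perm V) (hX : IsGTree X ρ) {b : G}
    (hb : ¬ Elliptic ρ b) {k : ℤ} (hk : k ≠ 0) : ¬ Elliptic ρ (b ^ k) := by
  obtain ⟨f, l, hl, hf, h⟩ := exists_axis X ρ hX b hb
  rintro ⟨p, hp⟩
  have h1 := axis_zpow ρ (axis_zpow ρ h k)
  have h2 : ∀ j : ℤ, ρ ((b ^ k) ^ j) p = p := by
    intro j
    rw [map_zpow]
    exact Equiv.Perm.zpow_apply_eq_self_of_apply_eq_self hp j
  set D := X.dist p (f 0)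
  have h3 := hf.2 0 (0 + (2 * D + 1 : ℤ) * (k * l))
  have h4 : X.dist p (f (0 + (2 * D + 1 : ℤ) * (k * l))) = D := by
    rw [← h1, ← h2 (2 * D + 1 : ℤ), gtree_dist X ρ hX]
  have h5 := hX.1.connected.dist_triangle (u := f 0) (v := p)
    (w := f (0 + (2 * D + 1 : ℤ) * (k * l)))
  rw [h4, h3] at h5
  have : 2 * D + 1 ≤ (0 + (2 * D + 1 : ℤ) * (k * l) - 0).natAbs := by
    rw [zero_add, sub_zero, Int.natAbs_mul]
    have h7 : k * l ≠ 0 := mul_ne_zero hk hl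
    have : 1 ≤ (k * l).natAbs := by omega
    have h2 : (2 * D + 1 : ℤ).natAbs = 2 * D + 1 := by omega
    rw [h2]
    exact Nat.le_mul_of_pos_right _ this
  have h6 : X.dist (f 0) p = D := SimpleGraph.dist_comm ..
  omega

/-- If an element fixes two distinct vertices it fixes an edge at the first. -/
theorem fix_edge (X : SimpleGraph V) (ρ : G →* Equiv.Perm V) (hX : IsGTree X ρ) {u v : V}
    (huv : u ≠ v) : ∃ w, X.Adj u w ∧ ∀ x : G, ρ x u = u → ρ x v = v → ρ x w = w := by
  obtain ⟨p, hp⟩ := hX.1.connected.exists_walk_length_eq_dist u v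
  cases p with
  | nil => exact absurd rfl huv
  | cons hadj p =>
    rename_i w
    refine ⟨w, hadj, fun x hu hv => ?_⟩
    have h1 := SimpleGraph.dist_le p
    rw [SimpleGraph.Walk.length_cons] at hp
    have h2 : X.dist u v ≤ X.dist w v + 1 := by
      have := hX.1.connected.dist_triangle (u := u) (v := w) (w := v)
      rw [SimpleGraph.dist_eq_one_iff_adj.2 hadj] at this
      omega
    have e : X.dist v w + 1 = X.dist v u := by
      rw [SimpleGraph.dist_comm, SimpleGraph.dist_comm (u := v)]; omega
    have a := hX.2.1 x u w hadj
    rw [hu] at a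
    refine tree_closer_unique hX.1 (r := v) a.symm hadj.symm ?_ e
    rw [← e]
    congr 1
    conv_lhs => rw [← hv]
    exact gtree_dist X ρ hX x v w

end TreeLemmas

section GroupLemmas

variable {G V : Type} [Group G]

theorem mem_vStab (ρ : G →* Equiv.Perm V) (v : V) (g : G) : g ∈ vStab ρ v ↔ ρ g v = v := by
  simp [vStab, Subgroup.mem_comap, MulAction.mem_stabilizer_iff]

/-- Infinite cyclic subgroups have no torsion. -/
theorem infCyclic_zpow_ne {H : Subgroup G} (hH : IsInfCyclic H) {a : G} (ha : a ∈ H)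
    (h1 : a ≠ 1) {m : ℤ} (hm : m ≠ 0) : a ^ m ≠ 1 := by
  obtain ⟨hc, hi⟩ := hH
  obtain ⟨z, hz⟩ := hc.exists_generator
  have hz0 : orderOf z = 0 := by
    rw [orderOf_eq_card_of_forall_mem_zpowers hz]
    exact Nat.card_eq_zero_of_infinite
  obtain ⟨p, hp⟩ := Subgroup.mem_zpowers_iff.1 (hz ⟨a, ha⟩)
  intro h
  have h2 : z ^ (p * m) = 1 := by
    rw [zpow_mul, hp]
    ext
    simpa using h
  have h3 : p * m = 0 := by
    have := orderOf_dvd_iff_zpow_eq_one.2 h2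
    rw [hz0] at this
    simpa using this
  rcases mul_eq_zero.1 h3 with h4 | h4
  · rw [h4] at hp
    apply h1
    simpa using (congrArg Subtype.val hp).symm
  · exact hm h4

theorem infCyclic_comm {H : Subgroup G} (hH : IsInfCyclic H) {a b : G} (ha : a ∈ H) (hb : b ∈ H)
    (h1 : a ≠ 1) (h2 : b ≠ 1) : CommElts a b := by
  obtain ⟨z, hz⟩ := hH.1.exists_generator
  obtain ⟨p, hp⟩ := Subgroup.mem_zpowers_iff.1 (hz ⟨a, ha⟩)
  obtain ⟨q, hq⟩ := Subgroup.mem_zpowers_iff.1 (hz ⟨b, hb⟩)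
  have hp' : (z : G) ^ p = a := by simpa using congrArg Subtype.val hp
  have hq' : (z : G) ^ q = b := by simpa using congrArg Subtype.val hq
  refine ⟨q, p, ?_, ?_, ?_⟩
  · rintro rfl; exact h2 (by simpa using hq'.symm)
  · rintro rfl; exact h1 (by simpa using hp'.symm)
  · rw [← hp', ← hq', ← zpow_mul, ← zpow_mul, mul_comm]

theorem gbs_power_mem {X : SimpleGraph V} {ρ : G →* Equiv.Perm V} (hX : IsGBSTree X ρ)
    {v w : V} (p : X.Walk v w) : ∀ {a : G}, a ∈ vStab ρ v → a ≠ 1 →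
      ∃ m : ℤ, m ≠ 0 ∧ a ^ m ∈ vStab ρ w := by
  induction p with
  | nil => intro a ha _; exact ⟨1, one_ne_zero, by simpa using ha⟩
  | cons hadj p ih =>
    rename_i x y z
    intro a ha h1
    have hi := (hX.2.2 _ _ hadj).2
    obtain ⟨d, hd⟩ := exists_ne (1 : eStab ρ x y)
    have hd1 : (d : G) ≠ 1 := fun h => hd (by ext; simpa using h)
    have hdx : (d : G) ∈ vStab ρ x := d.2.1
    have hdy : (d : G) ∈ vStab ρ y := d.2.2
    obtain ⟨i, j, hi, hj, e⟩ := infCyclic_comm (hX.2.1 x) ha hdx h1 hd1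
    have h3 : a ^ i ∈ vStab ρ y := by rw [e]; exact Subgroup.zpow_mem _ hdy j
    obtain ⟨m, hm, h4⟩ := ih h3 (infCyclic_zpow_ne (hX.2.1 x) ha h1 hi)
    exact ⟨i * m, mul_ne_zero hi hm, by rw [zpow_mul]; exact h4⟩

theorem gbs_comm {X : SimpleGraph V} {ρ : G →* Equiv.Perm V} (hX : IsGBSTree X ρ)
    {v : V} {a : G} (ha : a ∈ vStab ρ v) (h1 : a ≠ 1) (g : G) : CommElts (g * a * g⁻¹) a := by
  have h2 : g * a * g⁻¹ ∈ vStab ρ (ρ g v) := by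
    rw [mem_vStab] at ha ⊢
    simp [map_mul, Equiv.Perm.mul_apply, ha]
  have h3 : g * a * g⁻¹ ≠ 1 := by simpa [mul_inv_eq_one] using h1
  obtain ⟨p⟩ := hX.1.1.connected (ρ g v) v
  obtain ⟨m, hm, h4⟩ := gbs_power_mem hX p h2 h3
  obtain ⟨i, j, hi, hj, e⟩ := infCyclic_comm (hX.2.1 v) h4 ha
    (infCyclic_zpow_ne (hX.2.1 _) h2 h3 hm) h1
  exact ⟨m * i, j, mul_ne_zero hm hi, hj, by rw [zpow_mul]; exact e⟩

theorem gbs_torsionFree {X : SimpleGraph V} {ρ : G →* Equiv.Perm V} (hX : IsGBSTree X ρ)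
    {g : G} (h1 : g ≠ 1) {m : ℤ} (hm : m ≠ 0) : g ^ m ≠ 1 := by
  by_cases hg : Elliptic ρ g
  · obtain ⟨v, hv⟩ := hg
    exact infCyclic_zpow_ne (hX.2.1 v) ((mem_vStab ρ v g).2 hv) h1 hm
  · intro h
    apply hyp_zpow X ρ hX.1 hg hm
    obtain ⟨v⟩ := hX.1.1.connected.nonempty
    exact ⟨v, by rw [h]; simp⟩

/-- The theorem for a cyclic edge group. -/
theorem gbs_cyclic_case
    (X : SimpleGraph V) (ρ : G →* Equiv.Perm V) (hX : IsGBSTree X ρ)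
    (hline : ¬ ∃ L : Set V, IsLine X L ∧ ∀ g : G, ⇑(ρ g) '' L = L)
    (C : Subgroup G) (c : G) (hC : C = Subgroup.zpowers c) (hsplit : SplitsOver G C) :
    ∃ v : V, C ≤ vStab ρ v := by
  by_cases hc : Elliptic ρ c
  · obtain ⟨v, hv⟩ := hc
    refine ⟨v, ?_⟩
    rw [hC, Subgroup.zpowers_le, mem_vStab]
    exact hv
  exfalso
  obtain ⟨W, T, σ, u, v, hT, huv, hst, hnofix, horb⟩ := hsplit
  have hcC : c ∈ C := by rw [hC]; exact Subgroup.mem_zpowers c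
  -- edge stabilizers in T are conjugates of C
  have hedge : ∀ x y : W, T.Adj x y → ∃ k : G, ∀ g : G,
      (σ g x = x ∧ σ g y = y) ↔ k⁻¹ * g * k ∈ C := by
    intro x y hxy
    obtain ⟨k, hk⟩ := horb x y hxy
    refine ⟨k, fun g => ?_⟩
    rw [← hst, eStab, Subgroup.mem_inf, mem_vStab, mem_vStab]
    have key : ∀ z : W, σ (k⁻¹ * g * k) z = z ↔ σ g (σ k z) = σ k z := by
      intro z
      rw [map_mul, map_mul, map_inv, Equiv.Perm.mul_apply, Equiv.Perm.mul_apply,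
        Equiv.Perm.inv_eq_iff_eq]
    rw [key, key]
    rcases hk with ⟨h1, h2⟩ | ⟨h1, h2⟩
    · rw [h1, h2]
    · rw [h1, h2, and_comm]
  obtain ⟨v0⟩ := hX.1.1.connected.nonempty
  have hinf := (hX.2.1 v0).2
  obtain ⟨⟨a, ha⟩, ha1⟩ := exists_ne (1 : vStab ρ v0)
  have ha1 : a ≠ 1 := fun h => ha1 (by ext; simpa using h)
  have hcomm := gbs_comm hX ha ha1
  by_cases hea : Elliptic σ a
  · obtain ⟨w, hw⟩ := hea
    apply hnofix
    refine ⟨w, fun g => ?_⟩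
    by_contra hne
    obtain ⟨m, n, hm, hn, e⟩ := hcomm g
    have f1 : σ (a ^ n) w = w := by
      rw [map_zpow]; exact Equiv.Perm.zpow_apply_eq_self_of_apply_eq_self hw n
    have f2 : σ (a ^ n) (σ g w) = σ g w := by
      rw [← e, map_zpow]
      apply Equiv.Perm.zpow_apply_eq_self_of_apply_eq_self
      simp [map_mul, Equiv.Perm.mul_apply, hw]
    obtain ⟨w', hadj, hfix⟩ := fix_edge T σ hT (Ne.symm hne)
    obtain ⟨k, hk⟩ := hedge w w' hadj
    have h3 := (hk (a ^ n)).1 ⟨f1, hfix _ f1 f2⟩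
    rw [hC] at h3
    obtain ⟨j, hj⟩ := Subgroup.mem_zpowers_iff.1 h3
    have han : a ^ n ≠ 1 := infCyclic_zpow_ne (hX.2.1 v0) ha ha1 hn
    have hj0 : j ≠ 0 := by
      rintro rfl
      apply han
      rw [zpow_zero] at hj
      have : a ^ n = k * (k⁻¹ * a ^ n * k) * k⁻¹ := by group
      rw [this, ← hj]; group
    apply hyp_zpow X ρ hX.1 hc hj0
    refine ⟨ρ k⁻¹ v0, ?_⟩
    have han0 : ρ (a ^ n) v0 = v0 := (mem_vStab _ _ _).1 (Subgroup.zpow_mem _ ha n)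
    rw [hj]
    simp only [map_mul, Equiv.Perm.mul_apply, map_inv]
    simpa using han0
  · obtain ⟨f, l, hl, hf, h⟩ := exists_axis T σ hT a hea
    have hinv : ∀ g, ⇑(σ g) '' (Set.range f) = Set.range f := fun g =>
      axis_invariant T σ hT hf hl h (hcomm g)
    have hfixline : ∀ x : G, σ x (f 0) = f 0 → σ x (f 1) = f 1 → ∀ n, σ x (f n) = f n := by
      intro x h0 h1 n
      have : σ x (f n) ∈ Set.range f := by
        rw [← hinv x]; exact ⟨f n, ⟨n, rfl⟩, rfl⟩
      obtain ⟨m, hm⟩ := this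
      have e0 := gtree_dist T σ hT x (f 0) (f n)
      have e1 := gtree_dist T σ hT x (f 1) (f n)
      rw [h0, ← hm, hf.2, hf.2] at e0
      rw [h1, ← hm, hf.2, hf.2] at e1
      have : m = n := by omega
      rw [← hm, this]
    obtain ⟨k, hk⟩ := hedge (f 0) (f 1) (by simpa using hf.1 0)
    have hnormal : ∀ g : G, g * c * g⁻¹ ∈ C := by
      intro g
      have h1 := (hk (k * c * k⁻¹)).2 (by
        have : k⁻¹ * (k * c * k⁻¹) * k = c := by group
        rw [this]; exact hcC)
      have h2 := hfixline _ h1.1 h1.2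
      have h3 : ∀ n, σ ((k * g * k⁻¹) * (k * c * k⁻¹) * (k * g * k⁻¹)⁻¹) (f n) = f n := by
        intro n
        have : σ ((k * g * k⁻¹)⁻¹) (f n) ∈ Set.range f := by
          rw [← hinv ((k * g * k⁻¹)⁻¹)]; exact ⟨f n, ⟨n, rfl⟩, rfl⟩
        obtain ⟨m, hm⟩ := this
        rw [map_mul, map_mul, Equiv.Perm.mul_apply, Equiv.Perm.mul_apply, ← hm, h2, hm,
          ← Equiv.Perm.mul_apply, ← map_mul]
        simp
      have h4 := (hk _).1 ⟨h3 0, h3 1⟩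
      have : k⁻¹ * (k * g * k⁻¹ * (k * c * k⁻¹) * (k * g * k⁻¹)⁻¹) * k = g * c * g⁻¹ := by group
      rwa [this] at h4
    obtain ⟨f', l', hl', hf', h'⟩ := exists_axis X ρ hX.1 c hc
    apply hline
    refine ⟨Set.range f', hf'.isLine, fun g => axis_invariant X ρ hX.1 hf' hl' h' ?_⟩
    have h5 := hnormal g
    rw [hC] at h5
    obtain ⟨j, hj⟩ := Subgroup.mem_zpowers_iff.1 h5
    refine ⟨1, j, one_ne_zero, ?_, by rw [hj, zpow_one]⟩
    rintro rfl
    apply hc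
    rw [zpow_zero] at hj
    have : c = 1 := by
      have : c = g⁻¹ * (g * c * g⁻¹) * g := by group
      rw [this, ← hj]; group
    exact ⟨v0, by rw [this]; simp⟩

end GroupLemmas

section EndsLemmas

/-- Vertices incident to an edge crossing between `A` and its complement. -/
def vbd {U : Type} (Γ : SimpleGraph U) (A : Set U) : Set U :=
  {x | ∃ y, Γ.Adj x y ∧ ¬ (x ∈ A ↔ y ∈ A)}

theorem vbd_compl {U : Type} (Γ : SimpleGraph U) (A : Set U) : vbd Γ Aᶜ = vbd Γ A := by
  ext x
  simp only [vbd, Set.mem_ofPred_eq, Set.mem_compl_iff, not_iff_not]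

theorem vbd_inter {U : Type} (Γ : SimpleGraph U) (A B : Set U) :
    vbd Γ (A ∩ B) ⊆ vbd Γ A ∪ vbd Γ B := by
  rintro x ⟨y, hxy, h⟩
  by_contra hc
  simp only [Set.mem_union, not_or, vbd, Set.mem_ofPred_eq, not_exists, not_and, not_not] at hc
  exact h (and_congr (hc.1 y hxy) (hc.2 y hxy))

theorem walk_cross {U : Type} {Γ : SimpleGraph U} {A : Set U} {x y : U} (w : Γ.Walk x y)
    (h : ∀ z ∈ w.support, z ∉ vbd Γ A) : x ∈ A ↔ y ∈ A := by
  induction w with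
  | nil => rfl
  | cons hadj p ih =>
    rename_i a b c
    have h1 : a ∈ A ↔ b ∈ A := by
      by_contra hc
      exact h a (by simp) ⟨b, hadj, hc⟩
    rw [h1]
    exact ih (fun z hz => h z (by simp [hz]))

theorem vbd_empty {U : Type} {Γ : SimpleGraph U} (hΓ : Γ.Preconnected) {A : Set U}
    (h : vbd Γ A = ∅) (x y : U) : x ∈ A ↔ y ∈ A := by
  obtain ⟨w⟩ := hΓ x y
  exact walk_cross w (fun z _ => by simp [h])

theorem exists_end_of_infinite {U : Type} (Γ : SimpleGraph U) [Γ.LocallyFinite]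
    [Fact Γ.Preconnected] (K : Finset U) (D : Γ.ComponentCompl (K : Set U))
    (hD : D.supp.Infinite) : ∃ e : Γ.end, e.val (Opposite.op K) = D := by
  have hinf : Infinite U := by
    by_contra h
    rw [not_infinite_iff_finite] at h
    exact hD (Set.toFinite _)
  let F := Γ.componentComplFunctor
  have hML : F.IsMittagLeffler := F.isMittagLeffler_of_exists_finite_range
    (fun j => ⟨j, CategoryTheory.CategoryStruct.id j, Set.toFinite _⟩)
  have hne := F.toEventualRanges_nonempty hML
  have hsurj := F.toEventualRanges.eval_section_surjective_of_surjective
    (F.surjective_toEventualRanges hML) (Opposite.op K)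
  have hDe : (show F.obj (Opposite.op K) from D) ∈ F.eventualRange (Opposite.op K) :=
    (Γ.infinite_iff_in_eventualRange (K := Opposite.op K) D).1 hD
  obtain ⟨s, hs⟩ := hsurj ⟨D, hDe⟩
  refine ⟨F.toEventualRangesSectionsEquiv s, ?_⟩
  exact congrArg Subtype.val hs

theorem exists_inf_component {U : Type} (Γ : SimpleGraph U) [Γ.LocallyFinite]
    [Fact Γ.Preconnected] (K : Finset U) (A : Set U) (hA : A.Infinite) (hK : vbd Γ A ⊆ K) :
    ∃ D : Γ.ComponentCompl (K : Set U), D.supp.Infinite ∧ D.supp ⊆ A := by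
  have hmono : ∀ D : Γ.ComponentCompl (K : Set U), (D.supp ∩ A).Nonempty → D.supp ⊆ A := by
    rintro D ⟨x, ⟨hxK, hx⟩, hxA⟩ y ⟨hyK, hy⟩
    let φ : Γ.ComponentCompl (K : Set U) → Prop := SimpleGraph.ComponentCompl.lift
      (fun v _ => v ∈ A) (fun v w hv hw hvw => by
        by_contra hc
        exact hv (hK ⟨w, hvw, fun h => hc (propext h)⟩))
    have e1 : φ (Γ.componentComplMk hxK) = (x ∈ A) := rfl
    have e2 : φ (Γ.componentComplMk hyK) = (y ∈ A) := rfl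
    rw [hx] at e1
    rw [hy] at e2
    rw [← e2, e1]
    exact hxA
  have hfin : Finite (Γ.ComponentCompl (K : Set U)) := Γ.componentCompl_finite K
  by_contra hc
  push Not at hc
  have h1 : A ⊆ K ∪ ⋃ D : {D : Γ.ComponentCompl (K : Set U) // (D.supp ∩ A).Nonempty},
      D.1.supp := by
    intro x hx
    by_cases hxK : x ∈ (K : Set U)
    · exact Or.inl hxK
    · refine Or.inr (Set.mem_iUnion.2 ⟨⟨Γ.componentComplMk hxK, x, ⟨hxK, rfl⟩, hx⟩, ⟨hxK, rfl⟩⟩)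
  refine hA (Set.Finite.subset (K.finite_toSet.union (Set.finite_iUnion fun D => ?_)) h1)
  by_contra hi
  exact hc D.1 hi (hmono D.1 D.2)

theorem three_sets {U : Type} (Γ : SimpleGraph U) [Γ.LocallyFinite]
    [Fact Γ.Preconnected] (h2 : Nat.card Γ.end = 2) (A B C : Set U)
    (hA : A.Infinite) (hB : B.Infinite) (hC : C.Infinite)
    (fA : (vbd Γ A).Finite) (fB : (vbd Γ B).Finite) (fC : (vbd Γ C).Finite)
    (hAB : Disjoint A B) (hAC : Disjoint A C) (hBC : Disjoint B C) : False := by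
  classical
  let K : Finset U := fA.toFinset ∪ fB.toFinset ∪ fC.toFinset
  have kA : vbd Γ A ⊆ K := by intro x hx; simp [K, hx]
  have kB : vbd Γ B ⊆ K := by intro x hx; simp [K, hx]
  have kC : vbd Γ C ⊆ K := by intro x hx; simp [K, hx]
  obtain ⟨DA, iA, sA⟩ := exists_inf_component Γ K A hA kA
  obtain ⟨DB, iB, sB⟩ := exists_inf_component Γ K B hB kB
  obtain ⟨DC, iC, sC⟩ := exists_inf_component Γ K C hC kC
  obtain ⟨eA, hA'⟩ := exists_end_of_infinite Γ K DA iA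
  obtain ⟨eB, hB'⟩ := exists_end_of_infinite Γ K DB iB
  obtain ⟨eC, hC'⟩ := exists_end_of_infinite Γ K DC iC
  have nAB : eA ≠ eB := by
    rintro rfl
    obtain ⟨x, hx⟩ := iA.nonempty
    exact Set.disjoint_left.1 hAB (sA hx) (sB (by rw [← hB', hA']; exact hx))
  have nAC : eA ≠ eC := by
    rintro rfl
    obtain ⟨x, hx⟩ := iA.nonempty
    exact Set.disjoint_left.1 hAC (sA hx) (sC (by rw [← hC', hA']; exact hx))
  have nBC : eB ≠ eC := by
    rintro rfl
    obtain ⟨x, hx⟩ := iB.nonempty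
    exact Set.disjoint_left.1 hBC (sB hx) (sC (by rw [← hC', hB']; exact hx))
  obtain ⟨x, y, -, hu⟩ := Nat.card_eq_two_iff.1 h2
  have mem : ∀ e : Γ.end, e = x ∨ e = y := fun e => by
    have : e ∈ ({x, y} : Set Γ.end) := by rw [hu]; trivial
    simpa using this
  rcases mem eA with h | h <;> rcases mem eB with h' | h' <;> rcases mem eC with h'' | h'' <;>
    simp_all

theorem exists_cut {U : Type} (Γ : SimpleGraph U) [Γ.LocallyFinite]
    (h2 : Nat.card Γ.end = 2) : ∃ E : Set U, E.Infinite ∧ Eᶜ.Infinite ∧ (vbd Γ E).Finite := by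
  classical
  obtain ⟨e, e', hne, -⟩ := Nat.card_eq_two_iff.1 h2
  obtain ⟨K, hK⟩ : ∃ K, e.val K ≠ e'.val K := by
    by_contra hc
    push Not at hc
    exact hne (Subtype.ext (funext hc))
  have i1 := Γ.end_componentCompl_infinite e K
  have i2 := Γ.end_componentCompl_infinite e' K
  have hd : Disjoint (SimpleGraph.ComponentCompl.supp (e.val K))
      (SimpleGraph.ComponentCompl.supp (e'.val K)) :=
    SimpleGraph.ComponentCompl.pairwise_disjoint hK
  refine ⟨(e.val K).supp, i1, i2.mono ?_, ?_⟩
  · intro x hx hx'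
    exact Set.disjoint_left.1 hd hx' hx
  · refine ((K.unop ∪ K.unop.biUnion (fun v => Γ.neighborFinset v)).finite_toSet).subset ?_
    rintro x ⟨y, hxy, h⟩
    by_contra hc
    simp only [Finset.coe_union, Set.mem_union, Finset.mem_coe, not_or, Finset.mem_biUnion,
      SimpleGraph.mem_neighborFinset, not_exists, not_and] at hc
    obtain ⟨hxK, hyK⟩ := hc
    have hyK' : y ∉ K.unop := fun hy => hyK y hy hxy.symm
    apply h
    constructor
    · intro hx
      exact SimpleGraph.ComponentCompl.mem_of_adj (C := e.val K) x y hx (by simpa using hyK') hxy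
    · intro hy
      exact SimpleGraph.ComponentCompl.mem_of_adj (C := e.val K) y x hy (by simpa using hxK) hxy.symm

end EndsLemmas

section TwoEndedGroups

variable {C : Type} [Group C]

theorem cayley_adj_mul (S : Set C) (g x y : C) :
    (cayley C S).Adj (g * x) (g * y) ↔ (cayley C S).Adj x y := by
  simp [cayley, SimpleGraph.fromRel_adj, mul_assoc]

theorem cayley_preconnected (S : Set C) (hS : Subgroup.closure S = ⊤) :
    (cayley C S).Preconnected := by
  have h1 : ∀ g : C, ∀ x : C, (cayley C S).Reachable x (x * g) := by
    intro g
    have hg : g ∈ Subgroup.closure S := by rw [hS]; trivial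
    induction hg using Subgroup.closure_induction with
    | mem s hs =>
      intro x
      by_cases h : x = x * s
      · rw [← h]
      · apply SimpleGraph.Adj.reachable
        simp only [cayley, SimpleGraph.fromRel_adj]
        exact ⟨h, Or.inl (by simpa using hs)⟩
    | one => intro x; simp
    | mul a b _ _ iha ihb =>
      intro x
      rw [← mul_assoc]
      exact (iha x).trans (ihb _)
    | inv a _ iha =>
      intro x
      have := (iha (x * a⁻¹)).symm
      simpa using this
  intro x y
  simpa using h1 (x⁻¹ * y) x

theorem cayley_locallyFinite (S : Finset C) (x : C) :
    ((cayley C (S : Set C)).neighborSet x).Finite := by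
  refine ((S.finite_toSet.image (fun s => x * s)).union
    (S.finite_toSet.image (fun s => x * s⁻¹))).subset ?_
  intro y hy
  simp only [cayley, SimpleGraph.mem_neighborSet, SimpleGraph.fromRel_adj] at hy
  rcases hy.2 with h | h
  · exact Or.inl ⟨_, h, by simp⟩
  · exact Or.inr ⟨_, h, by simp⟩

/-- Left translate of a set. -/
def ltr (g : C) (E : Set C) : Set C := {x | g⁻¹ * x ∈ E}

theorem mem_ltr (g x : C) (E : Set C) : x ∈ ltr g E ↔ g⁻¹ * x ∈ E := Iff.rfl

theorem ltr_infinite (g : C) {E : Set C} (h : E.Infinite) : (ltr g E).Infinite := by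
  have : ltr g E = (fun x => g * x) '' E := by
    ext x
    constructor
    · intro hx; exact ⟨_, hx, by simp⟩
    · rintro ⟨y, hy, rfl⟩; simpa [ltr] using hy
  rw [this]
  exact h.image (mul_right_injective g).injOn

theorem ltr_finite (g : C) {E : Set C} (h : E.Finite) : (ltr g E).Finite :=
  h.preimage (mul_right_injective g⁻¹).injOn

theorem vbd_ltr (S : Set C) (g : C) (E : Set C) :
    vbd (cayley C S) (ltr g E) = ltr g (vbd (cayley C S) E) := by
  ext x
  constructor
  · rintro ⟨y, hxy, h⟩
    exact ⟨g⁻¹ * y, (cayley_adj_mul S _ _ _).2 hxy, h⟩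
  · rintro ⟨y, hxy, h⟩
    refine ⟨g * y, ?_, ?_⟩
    · rw [← cayley_adj_mul S g⁻¹]; simpa using hxy
    · simpa [ltr] using h

/-- A nested pair gives a finite index cyclic subgroup. -/
theorem finite_quotient_of_nested (htf : ∀ x : C, x ≠ 1 → ∀ n : ℤ, n ≠ 0 → x ^ n ≠ 1)
    (S : Set C) (hconn : (cayley C S).Preconnected) (E : Set C)
    (hbd : (vbd (cayley C S) E).Finite) (g : C) (hsub : ∀ x, g⁻¹ * x ∈ E → x ∈ E)
    (d : C) (hd : d ∈ E) (hd' : g⁻¹ * d ∉ E) (hfin : {x | x ∈ E ∧ g⁻¹ * x ∉ E}.Finite) :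
    Finite (C ⧸ Subgroup.zpowers g) := by
  have hg1 : g ≠ 1 := by rintro rfl; simp at hd'; exact hd' hd
  have hinj : ∀ x : C, Function.Injective (fun n : ℤ => g ^ n * x) := by
    intro x m n h
    have h1 : g ^ m = g ^ n := mul_right_cancel h
    by_contra hmn
    apply htf g hg1 (m - n) (sub_ne_zero.2 hmn)
    rw [zpow_sub, h1, mul_inv_cancel]
  have hexc : ∀ x y : C, {n : ℤ | ¬ (g ^ n * x ∈ E ↔ g ^ n * y ∈ E)}.Finite := by
    intro x y
    obtain ⟨w⟩ := hconn x y
    induction w with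
    | nil => simp
    | cons hadj p ih =>
      rename_i a b c
      have h1 : {n : ℤ | g ^ n * a ∈ vbd (cayley C S) E}.Finite :=
        hbd.preimage (f := fun n : ℤ => g ^ n * a) (hinj a).injOn
      refine (h1.union ih).subset ?_
      intro n hn
      by_contra hc
      simp only [Set.mem_union, not_or, Set.mem_ofPred_eq, not_not] at hc
      apply hn
      rw [← hc.2]
      by_contra hc2
      exact hc.1 ⟨g ^ n * b, (cayley_adj_mul S _ _ _).2 hadj, hc2⟩
  have hup : ∀ n : ℕ, g ^ (n : ℤ) * d ∈ E := by
    intro n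
    induction n with
    | zero => simpa using hd
    | succ n ih =>
      apply hsub
      have : g⁻¹ * (g ^ ((n + 1 : ℕ) : ℤ) * d) = g ^ (n : ℤ) * d := by
        push_cast; rw [add_comm, zpow_add, zpow_one]; group
      rw [this]; exact ih
  have hdown : ∀ n : ℕ, g ^ (-(n : ℤ) - 1) * d ∉ E := by
    intro n
    induction n with
    | zero => simpa using hd'
    | succ n ih =>
      intro h
      apply ih
      apply hsub
      have : g⁻¹ * (g ^ (-(n : ℤ) - 1) * d) = g ^ (-((n + 1 : ℕ) : ℤ) - 1) * d := by
        rw [← mul_assoc, ← zpow_neg_one, ← zpow_add]; congr 2; push_cast; ring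
      rw [this]; exact h
  have hhit : ∀ x : C, ∃ n : ℤ, g ^ n * x ∈ {x | x ∈ E ∧ g⁻¹ * x ∉ E} := by
    intro x
    obtain ⟨n1, hn1⟩ : ∃ n : ℤ, g ^ n * x ∈ E := by
      obtain ⟨n, hn, hn'⟩ := ((Set.Ici_infinite (0 : ℤ)).sdiff (hexc x d)).nonempty
      obtain ⟨k, rfl⟩ := Int.eq_ofNat_of_zero_le hn
      refine ⟨k, ?_⟩
      simp only [Set.mem_ofPred_eq, not_not] at hn'
      exact hn'.2 (hup k)
    obtain ⟨n2, hn2⟩ : ∃ n : ℤ, g ^ n * x ∉ E := by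
      obtain ⟨n, hn, hn'⟩ := ((Set.Iic_infinite (-1 : ℤ)).sdiff (hexc x d)).nonempty
      refine ⟨n, ?_⟩
      simp only [Set.mem_ofPred_eq, not_not] at hn'
      rw [hn']
      have hn0 : n ≤ -1 := hn
      have := hdown (-n - 1).toNat
      rwa [Int.toNat_of_nonneg (by omega), show -(-n - 1) - 1 = n by ring] at this
    have hstep : ∀ n : ℤ, g⁻¹ * (g ^ (n + 1) * x) = g ^ n * x := by
      intro n; rw [add_comm, zpow_add, zpow_one]; group
    by_contra hc
    push Not at hc
    have hall : ∀ k : ℕ, g ^ (n1 - k) * x ∈ E := by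
      intro k
      induction k with
      | zero => simpa using hn1
      | succ k ih =>
        by_contra h
        apply hc (n1 - k)
        refine ⟨ih, ?_⟩
        have := hstep (n1 - (k + 1 : ℕ))
        push_cast at this h
        rw [show n1 - ((k : ℤ) + 1) + 1 = n1 - k by ring] at this
        rw [this]; exact h
    have hall2 : ∀ k : ℕ, g ^ (n1 + k) * x ∈ E := by
      intro k
      induction k with
      | zero => simpa using hn1
      | succ k ih =>
        apply hsub
        push_cast
        rw [← add_assoc, hstep]
        exact ih
    apply hn2
    rcases le_total n1 n2 with h | h
    · obtain ⟨k, rfl⟩ := Int.le.dest h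
      exact hall2 k
    · obtain ⟨k, hk⟩ := Int.le.dest h
      have := hall k
      rwa [← hk, add_sub_cancel_right] at this
  have := hfin.to_subtype
  refine Finite.of_surjective (fun y : {x | x ∈ E ∧ g⁻¹ * x ∉ E} =>
    (QuotientGroup.mk (y : C)⁻¹ : C ⧸ Subgroup.zpowers g)) ?_
  intro q
  induction q using QuotientGroup.induction_on with
  | H x =>
    obtain ⟨n, hn⟩ := hhit x⁻¹
    refine ⟨⟨_, hn⟩, ?_⟩
    rw [QuotientGroup.eq]
    refine Subgroup.mem_zpowers_iff.2 ⟨n, ?_⟩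
    simp

theorem isCyclic_of_finite_quotient (htf : ∀ x : C, x ≠ 1 → ∀ n : ℤ, n ≠ 0 → x ^ n ≠ 1)
    (g : C) (h : Finite (C ⧸ Subgroup.zpowers g)) : IsCyclic C := by
  have hfi : (Subgroup.zpowers g).FiniteIndex := Subgroup.finiteIndex_of_finite_quotient
  have htf' : ∀ x : C, ∀ n : ℕ, n ≠ 0 → x ^ n = 1 → x = 1 := by
    intro x n hn hx
    by_contra h1
    exact htf x h1 n (by exact_mod_cast hn) (by exact_mod_cast hx)
  let N := (Subgroup.zpowers g).normalCore
  have hNle : N ≤ Subgroup.zpowers g := Subgroup.normalCore_le _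
  have hNfi : N.FiniteIndex := Subgroup.finiteIndex_normalCore _
  have hNn : N.Normal := Subgroup.normalCore_normal _
  have hNc : IsCyclic N := isCyclic_of_injective (Subgroup.inclusion hNle)
    (Subgroup.inclusion_injective hNle)
  obtain ⟨⟨z, hzN⟩, hz⟩ := hNc.exists_generator
  have hz' : ∀ y ∈ N, ∃ j : ℤ, z ^ j = y := by
    intro y hy
    obtain ⟨j, hj⟩ := Subgroup.mem_zpowers_iff.1 (hz ⟨y, hy⟩)
    exact ⟨j, by simpa using congrArg Subtype.val hj⟩
  have hcen : N ≤ Subgroup.center C := by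
    intro y hy
    rw [Subgroup.mem_center_iff]
    intro x
    have hxz : x * z * x⁻¹ = z := by
      obtain ⟨j, hj⟩ := hz' _ (hNn.conj_mem z hzN x)
      obtain ⟨i, hi⟩ := hz' _ (N.pow_index_mem x)
      have e : z ^ (j * i) = z ^ i := by
        rw [zpow_mul, hj, conj_zpow, hi]
        group
      by_cases hz1 : z = 1
      · simp [hz1]
      have e2 : z ^ (j * i - i) = 1 := by rw [zpow_sub, e, mul_inv_cancel]
      have e3 : j * i - i = 0 := by
        by_contra hne
        exact htf z hz1 _ hne e2
      have e4 : (j - 1) * i = 0 := by linarith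
      rcases mul_eq_zero.1 e4 with h5 | h5
      · have : j = 1 := by omega
        rw [← hj, this, zpow_one]
      · rw [h5, zpow_zero] at hi
        have := htf' x _ hNfi.index_ne_zero hi.symm
        simp [this]
    have hc : Commute x z := by
      rw [mul_inv_eq_iff_eq_mul] at hxz
      exact hxz
    obtain ⟨j, rfl⟩ := hz' y hy
    exact (hc.zpow_right j).eq
  have hcfi : (Subgroup.center C).FiniteIndex := Subgroup.finiteIndex_of_le hcen
  have hcomm : ∀ x y : C, x * y = y * x := by
    intro x y
    have hinj : Function.Injective (MonoidHom.transferCenterPow C) := by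
      rw [injective_iff_map_eq_one]
      intro a ha
      apply htf' a _ hcfi.index_ne_zero
      rw [← MonoidHom.transferCenterPow_apply, ha]; rfl
    apply hinj
    rw [map_mul, map_mul]
    ext
    exact (Subgroup.mem_center_iff.1 (MonoidHom.transferCenterPow C y).2 _)
  let ψ : C →* N :=
    { toFun := fun x => ⟨x ^ N.index, N.pow_index_mem x⟩
      map_one' := by ext; simp
      map_mul' := fun a b => by
        ext
        exact (show Commute a b from hcomm a b).mul_pow _ }
  refine isCyclic_of_injective ψ ?_
  rw [injective_iff_map_eq_one]
  intro a ha
  apply htf' a _ hNfi.index_ne_zero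
  exact congrArg Subtype.val ha

theorem prop_aux {a b c d : Prop} (s1 : a ∨ b) (s2 : c ∨ d) (s3 : a ∨ c) (s4 : b ∨ d)
    (u1 : ¬ (a ∧ b ∧ c)) (u2 : ¬ (a ∧ b ∧ d)) (u3 : ¬ (a ∧ c ∧ d)) (u4 : ¬ (b ∧ c ∧ d)) :
    (¬ b ∧ ¬ c) ∨ (¬ a ∧ ¬ d) := by
  grind

theorem prop_aux2 {e f : Prop} (h : ¬ (f ↔ e)) : (e ∧ ¬ f) ∨ (¬ e ∧ f) := by
  grind

theorem prop_aux3 {e f : Prop} (h : ¬ (f ↔ ¬ e)) : (e ∧ f) ∨ (¬ e ∧ ¬ f) := by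
  grind

set_option maxHeartbeats 1000000 in
theorem twoEnded_isCyclic (htf : ∀ x : C, x ≠ 1 → ∀ n : ℤ, n ≠ 0 → x ^ n ≠ 1)
    (h : TwoEnded C) : IsCyclic C := by
  classical
  obtain ⟨S, hS, h2⟩ := h
  set Γ := cayley C (S : Set C) with hΓ
  have hconn : Γ.Preconnected := cayley_preconnected _ hS
  have : Fact Γ.Preconnected := ⟨hconn⟩
  let _ : Γ.LocallyFinite := fun x => (cayley_locallyFinite S x).fintype
  obtain ⟨E, hE, hEc, hbd⟩ := exists_cut Γ h2
  have hCinf : Infinite C := by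
    by_contra h
    rw [not_infinite_iff_finite] at h
    exact hE (Set.toFinite _)
  -- every translate is almost equal to `E` or its complement
  have halt : ∀ g : C, (∀ᶠ x in Filter.cofinite, (g⁻¹ * x ∈ E ↔ x ∈ E)) ∨
      (∀ᶠ x in Filter.cofinite, (g⁻¹ * x ∈ E ↔ x ∉ E)) := by
    intro g
    have bF : (vbd Γ (ltr g E)).Finite := by rw [vbd_ltr]; exact ltr_finite g hbd
    have iF := ltr_infinite g hE
    have iFc : (ltr g E)ᶜ.Infinite := ltr_infinite g hEc
    set F := ltr g E with hF
    have bEc : (vbd Γ Eᶜ).Finite := by rw [vbd_compl]; exact hbd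
    have bFc : (vbd Γ Fᶜ).Finite := by rw [vbd_compl]; exact bF
    have bi : ∀ A B : Set C, (vbd Γ A).Finite → (vbd Γ B).Finite → (vbd Γ (A ∩ B)).Finite :=
      fun A B hA hB => (hA.union hB).subset (vbd_inter Γ A B)
    have t3 := fun A B D hA hB hD => three_sets Γ h2 A B D hA hB hD
    have split : ∀ A B : Set C, A.Infinite → (A ∩ B).Infinite ∨ (A ∩ Bᶜ).Infinite := by
      intro A B hA
      rw [← Set.infinite_union]
      rwa [← Set.inter_union_distrib_left, Set.union_compl_self, Set.inter_univ]
    have d1 : Disjoint (E ∩ F) (E ∩ Fᶜ) :=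
      Set.disjoint_left.2 (fun x h h' => h'.2 h.2)
    have d2 : Disjoint (E ∩ F) (Eᶜ ∩ F) :=
      Set.disjoint_left.2 (fun x h h' => h'.1 h.1)
    have d3 : Disjoint (E ∩ F) (Eᶜ ∩ Fᶜ) :=
      Set.disjoint_left.2 (fun x h h' => h'.1 h.1)
    have d4 : Disjoint (E ∩ Fᶜ) (Eᶜ ∩ F) :=
      Set.disjoint_left.2 (fun x h h' => h'.1 h.1)
    have d5 : Disjoint (E ∩ Fᶜ) (Eᶜ ∩ Fᶜ) :=
      Set.disjoint_left.2 (fun x h h' => h'.1 h.1)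
    have d6 : Disjoint (Eᶜ ∩ F) (Eᶜ ∩ Fᶜ) :=
      Set.disjoint_left.2 (fun x h h' => h'.2 h.2)
    have b1 := bi E F hbd bF
    have b2 := bi E Fᶜ hbd bFc
    have b3 := bi Eᶜ F bEc bF
    have b4 := bi Eᶜ Fᶜ bEc bFc
    have s1 := split E F hE
    have s2 := split Eᶜ F hEc
    have s3 := split F E iF
    have s4 := split Fᶜ E iFc
    rw [Set.inter_comm F E, Set.inter_comm F Eᶜ] at s3
    rw [Set.inter_comm Fᶜ E, Set.inter_comm Fᶜ Eᶜ] at s4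
    have u1 : ¬ ((E ∩ F).Infinite ∧ (E ∩ Fᶜ).Infinite ∧ (Eᶜ ∩ F).Infinite) := fun ⟨x, y, z⟩ =>
      t3 _ _ _ x y z b1 b2 b3 d1 d2 d4
    have u2 : ¬ ((E ∩ F).Infinite ∧ (E ∩ Fᶜ).Infinite ∧ (Eᶜ ∩ Fᶜ).Infinite) := fun ⟨x, y, z⟩ =>
      t3 _ _ _ x y z b1 b2 b4 d1 d3 d5
    have u3 : ¬ ((E ∩ F).Infinite ∧ (Eᶜ ∩ F).Infinite ∧ (Eᶜ ∩ Fᶜ).Infinite) := fun ⟨x, y, z⟩ =>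
      t3 _ _ _ x y z b1 b3 b4 d2 d3 d6
    have u4 : ¬ ((E ∩ Fᶜ).Infinite ∧ (Eᶜ ∩ F).Infinite ∧ (Eᶜ ∩ Fᶜ).Infinite) := fun ⟨x, y, z⟩ =>
      t3 _ _ _ x y z b2 b3 b4 d4 d5 d6
    have fin : (¬ (E ∩ Fᶜ).Infinite ∧ ¬ (Eᶜ ∩ F).Infinite) ∨
        (¬ (E ∩ F).Infinite ∧ ¬ (Eᶜ ∩ Fᶜ).Infinite) := prop_aux s1 s2 s3 s4 u1 u2 u3 u4
    simp only [Set.not_infinite] at fin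
    rcases fin with ⟨f1, f2⟩ | ⟨f1, f2⟩
    · left
      rw [Filter.eventually_cofinite]
      refine (f1.union f2).subset ?_
      intro x hx
      simp only [Set.mem_ofPred_eq, ← mem_ltr, ← hF] at hx
      simp only [Set.mem_union, Set.mem_inter_iff, Set.mem_compl_iff]
      exact prop_aux2 hx
    · right
      rw [Filter.eventually_cofinite]
      refine (f1.union f2).subset ?_
      intro x hx
      simp only [Set.mem_ofPred_eq, ← mem_ltr, ← hF] at hx
      simp only [Set.mem_union, Set.mem_inter_iff, Set.mem_compl_iff]
      exact prop_aux3 hx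
  -- boundary points of E
  obtain ⟨x0, hx0⟩ := hE.nonempty
  obtain ⟨y0, hy0⟩ := hEc.nonempty
  obtain ⟨p0, hp0E, hp0⟩ : ∃ p, p ∈ E ∧ p ∈ vbd Γ E := by
    obtain ⟨w⟩ := hconn x0 y0
    obtain ⟨dd, -, hd1, hd2⟩ := w.exists_boundary_dart E hx0 hy0
    exact ⟨dd.fst, hd1, dd.snd, dd.adj, by simp [hd1, hd2]⟩
  obtain ⟨q0, hq0E, hq0⟩ : ∃ p, p ∉ E ∧ p ∈ vbd Γ E := by
    obtain ⟨y, hy, hyE⟩ := hp0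
    refine ⟨y, ?_, p0, hy.symm, fun h => hyE h.symm⟩
    intro h; exact hyE (by simp [h, hp0E])
  obtain ⟨K, hKsub, hKconn⟩ := SimpleGraph.extend_finset_to_connected hconn
    (t := hbd.toFinset) ⟨p0, by simpa using hp0⟩
  have hKbd : ∀ x ∈ vbd Γ E, x ∈ K := fun x hx => hKsub (by simpa using hx)
  have hKc : ∀ A : Set C, (∀ x ∈ K, x ∉ vbd Γ A) → ∀ x ∈ K, ∀ y ∈ K, (x ∈ A ↔ y ∈ A) := by
    intro A hA x hx y hy
    obtain ⟨w⟩ := hKconn.preconnected ⟨x, hx⟩ ⟨y, hy⟩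
    let w' := w.map (SimpleGraph.Embedding.induce (K : Set C)).toHom
    have hw : ∀ z ∈ w'.support, z ∉ vbd Γ A := by
      intro z hz
      have hz2 := hz
      simp only [w', SimpleGraph.Walk.support_map, List.mem_map] at hz2
      obtain ⟨a, -, rfl⟩ := hz2
      exact hA _ a.2
    exact walk_cross (Γ := Γ) (A := A) w' hw
  -- crossing lemma
  have hcross : ∀ A B : Set C, (∀ x ∈ vbd Γ A, x ∉ B) → (∀ x ∈ vbd Γ B, x ∉ A) →
      (∃ y, y ∉ A) → ∀ x ∈ A, x ∉ B := by
    intro A B hA hB ⟨y, hy⟩ x hxA hxB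
    have hemp : vbd Γ (A ∩ B) = ∅ := by
      rw [Set.eq_empty_iff_forall_notMem]
      rintro a ⟨b, hab, h⟩
      by_cases ha : a ∈ A ∩ B
      · have hb : b ∉ A ∩ B := fun hb => h (by simp only [ha, hb])
        by_cases hbA : b ∈ A
        · have hbB : b ∉ B := fun hbB => hb ⟨hbA, hbB⟩
          exact hB a ⟨b, hab, fun h => hbB (h.1 ha.2)⟩ ha.1
        · exact hA a ⟨b, hab, fun h => hbA (h.1 ha.1)⟩ ha.2
      · have hb : b ∈ A ∩ B := by by_contra hb; exact h (by simp only [ha, hb])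
        by_cases haA : a ∈ A
        · have haB : a ∉ B := fun haB => ha ⟨haA, haB⟩
          exact hB b ⟨a, hab.symm, fun h => haB (h.1 hb.2)⟩ hb.1
        · exact hA b ⟨a, hab.symm, fun h => haA (h.1 hb.1)⟩ hb.2
    exact hy ((vbd_empty hconn hemp x y).1 ⟨hxA, hxB⟩).1
  -- the finite set of elements moving `K` off itself fails
  let B : Set C := {g | ∃ x ∈ K, g * x ∈ K}
  have hBfin : B.Finite := by
    refine ((K ×ˢ K).image (fun p => p.2 * p.1⁻¹)).finite_toSet.subset ?_
    rintro g ⟨x, hx, hgx⟩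
    simp only [Finset.coe_image, Set.mem_image]
    exact ⟨(x, g * x), by simp [hx, hgx], by simp⟩
  obtain ⟨g, hgB, hg⟩ : ∃ g, g ∉ B ∧ ∀ᶠ x in Filter.cofinite, (g⁻¹ * x ∈ E ↔ x ∈ E) := by
    obtain ⟨g1, hg1⟩ := hBfin.infinite_compl.nonempty
    have hB2 : (B ∪ (fun b => g1 * b) '' B).Finite := hBfin.union (hBfin.image _)
    obtain ⟨g2, hg2⟩ := hB2.infinite_compl.nonempty
    rw [Set.mem_compl_iff, Set.mem_union, not_or] at hg2
    rcases halt g1 with h1 | h1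
    · exact ⟨g1, hg1, h1⟩
    rcases halt g2 with h2 | h2
    · exact ⟨g2, hg2.1, h2⟩
    refine ⟨g1⁻¹ * g2, fun h => hg2.2 ⟨_, h, by simp⟩, ?_⟩
    have ht := (mul_right_injective g1).tendsto_cofinite
    filter_upwards [ht.eventually h1, ht.eventually h2] with x hx1 hx2
    rw [inv_mul_cancel_left] at hx1
    rw [mul_inv_rev, inv_inv, mul_assoc, hx2, hx1]
  rw [Filter.eventually_cofinite] at hg
  have hgK : ∀ x ∈ K, g * x ∉ K := fun x hx h => hgB ⟨x, hx, h⟩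
  have hgK' : ∀ x ∈ K, g⁻¹ * x ∉ K := fun x hx h => hgB ⟨_, h, by simpa using hx⟩
  have hbF : ∀ x, x ∈ vbd Γ (ltr g E) ↔ g⁻¹ * x ∈ vbd Γ E := by
    intro x; rw [vbd_ltr]; rfl
  -- `g K` is on one side of `E`, `K` on one side of `g E`
  have hP := hKc (ltr g⁻¹ E) (fun x hx h => by
    rw [vbd_ltr, mem_ltr, inv_inv] at h
    exact hgK x hx (hKbd _ h))
  have hQ := hKc (ltr g E) (fun x hx h => by
    rw [vbd_ltr, mem_ltr] at h
    exact hgK' x hx (hKbd _ h))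
  simp only [mem_ltr, inv_inv] at hP hQ
  have hp0K := hKbd _ hp0
  have hq0K := hKbd _ hq0
  have iF := ltr_infinite g hE
  have iFc : (ltr g E)ᶜ.Infinite := ltr_infinite g hEc
  by_cases cP : g * p0 ∈ E
  · by_cases cQ : g⁻¹ * p0 ∈ E
    · -- complement of `g E` is inside `E`: impossible
      exfalso
      have := hcross (ltr g E)ᶜ Eᶜ
        (by
          intro x hx
          rw [vbd_compl, hbF] at hx
          have := (hP _ (hKbd _ hx) p0 hp0K).2 cP
          simpa using this)
        (by
          intro x hx
          rw [vbd_compl] at hx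
          have := (hQ _ (hKbd _ hx) p0 hp0K).2 cQ
          simpa [mem_ltr] using this)
        (by
          obtain ⟨y, hy⟩ := iF.nonempty
          exact ⟨y, by simpa using hy⟩)
      refine iFc (hg.subset ?_)
      intro x hx
      have h1 := this x hx
      simp only [Set.mem_compl_iff, not_not, mem_ltr] at h1 hx
      simp [h1, hx]
    · -- `g E ⊆ E`
      have := hcross (ltr g E) Eᶜ
        (by
          intro x hx
          rw [hbF] at hx
          have := (hP _ (hKbd _ hx) p0 hp0K).2 cP
          simpa using this)
        (by
          intro x hx
          rw [vbd_compl] at hx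
          have := mt (hQ _ (hKbd _ hx) p0 hp0K).1 cQ
          simpa [mem_ltr] using this)
        (by
          obtain ⟨y, hy⟩ := iFc.nonempty
          exact ⟨y, by simpa using hy⟩)
      refine isCyclic_of_finite_quotient htf g (finite_quotient_of_nested htf _ hconn E hbd g
        (fun x hx => by simpa using this x hx) p0 hp0E cQ (hg.subset ?_))
      rintro x ⟨h1, h2⟩
      simp [h1, h2]
  · by_cases cQ : g⁻¹ * p0 ∈ E
    · -- `E ⊆ g E`
      have := hcross (ltr g E)ᶜ E
        (by
          intro x hx
          rw [vbd_compl, hbF] at hx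
          have := mt (hP _ (hKbd _ hx) p0 hp0K).1 cP
          simpa using this)
        (by
          intro x hx
          have := (hQ _ (hKbd _ hx) p0 hp0K).2 cQ
          simpa [mem_ltr] using this)
        (by
          obtain ⟨y, hy⟩ := iF.nonempty
          exact ⟨y, by simpa using hy⟩)
      have hq := (hQ q0 hq0K p0 hp0K).2 cQ
      refine isCyclic_of_finite_quotient htf g⁻¹ (finite_quotient_of_nested htf _ hconn E hbd g⁻¹
        (fun x hx => ?_) (g⁻¹ * q0) hq (by simpa using hq0E) ?_)
      · by_contra hc
        rw [inv_inv] at hx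
        exact this (g * x) (by simpa [mem_ltr] using hc) hx
      · refine (ltr_finite g⁻¹ hg).subset ?_
        rintro x ⟨h1, h2⟩
        rw [inv_inv] at h2
        simp [mem_ltr, h1, h2]
    · -- `g E` is disjoint from `E`: impossible
      exfalso
      have := hcross (ltr g E) E
        (by
          intro x hx
          rw [hbF] at hx
          have := mt (hP _ (hKbd _ hx) p0 hp0K).1 cP
          simpa using this)
        (by
          intro x hx
          have := mt (hQ _ (hKbd _ hx) p0 hp0K).1 cQ
          simpa [mem_ltr] using this)
        (by
          obtain ⟨y, hy⟩ := iFc.nonempty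
          exact ⟨y, by simpa using hy⟩)
      refine iF (hg.subset ?_)
      intro x hx
      have h1 := this x hx
      rw [mem_ltr] at hx
      simp [h1, hx]

end TwoEndedGroups

/-- Let `X` be a generalized Baumslag–Solitar tree with group
`G`, with no `G`-invariant point or line. If `G` splits over a 2-ended subgroup
`C`, then `C` is contained in a vertex stabilizer of `X`. -/
theorem gbs_splitting_elliptic {G V : Type} [Group G]
    (X : SimpleGraph V) (ρ : G →* Equiv.Perm V) (hX : IsGBSTree X ρ)
    (hpt : ¬ ∃ v : V, ∀ g : G, ρ g v = v)
    (hline : ¬ ∃ L : Set V, IsLine X L ∧ ∀ g : G, ⇑(ρ g) '' L = L)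
    (C : Subgroup G) (hC : TwoEnded C) (hsplit : SplitsOver G C) :
    ∃ v : V, C ≤ vStab ρ v := by
  have htf : ∀ x : C, x ≠ 1 → ∀ n : ℤ, n ≠ 0 → x ^ n ≠ 1 := by
    intro x hx n hn h
    exact gbs_torsionFree hX (g := (x : G)) (fun h' => hx (by ext; simpa using h')) hn
      (by simpa using congrArg Subtype.val h)
  have hcyc := twoEnded_isCyclic htf hC
  obtain ⟨c, hc⟩ := hcyc.exists_generator
  refine gbs_cyclic_case X ρ hX hline C c ?_ hsplit
  ext x
  rw [Subgroup.mem_zpowers_iff]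
  constructor
  · intro hx
    obtain ⟨k, hk⟩ := Subgroup.mem_zpowers_iff.1 (hc ⟨x, hx⟩)
    exact ⟨k, by simpa using congrArg Subtype.val hk⟩
  · rintro ⟨k, rfl⟩
    exact C.zpow_mem c.2 k
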